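/- arXiv:2007.01521 — 2 statements merged into one kernel-verified Lean document; each statement's English description precedes it below -/
import Mathlib

section
/- Let U ⊆ P(d,m) be a color-squarefree monomial order ideal, let i be an index with m_i ≥ 1, and put Û = {u ∈ U : x_{i,1} does not divide u}. Then the deletion Δ_bal(U) \ {1^{(i)}} equals the simplicial complex generated by the sets F_d(u) for u ∈ Û; in particular, Δ_bal(U) \ {1^{(i)}} is isomorphic to the balanced complex of Û regarded as a color-squarefree order ideal in P(d,(m_1,…,m_{i−1}, m_i−1, m_{i+1},…,m_d)). -/
open Finset

noncomputable section

namespace BalSq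

variable {d : ℕ} {m : Fin d → ℕ}

/-- The set of variables `x_{i,j}` of `P(d,m)`: the variable `⟨i,j⟩` has color `i`. -/
abbrev Var (d : ℕ) (m : Fin d → ℕ) : Type := Σ i : Fin d, Fin (m i)

/-- Monomials of `P(d,m)`, encoded as exponent vectors. -/
abbrev Mon (d : ℕ) (m : Fin d → ℕ) : Type := Var d m →₀ ℕ

/-- The vertex set `V = V_1 ∪ ⋯ ∪ V_d`, where `V_i` has `m i + 1` elements;
these are also the variables of `P(d, m + (1,…,1))`. -/
abbrev Vtx (d : ℕ) (m : Fin d → ℕ) : Type := Σ i : Fin d, Fin (m i + 1)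

/-- The monomial `x_{i,j}`. -/
def xvar (i : Fin d) (j : Fin (m i)) : Mon d m := Finsupp.single ⟨i, j⟩ 1

/-- Total degree of a monomial. -/
def deg (u : Mon d m) : ℕ := u.sum fun _ n => n

/-- A monomial is color-squarefree if it is divisible by at most one variable of each color. -/
def ColorSquarefree (u : Mon d m) : Prop :=
  ∀ i : Fin d, (∑ j : Fin (m i), u ⟨i, j⟩) ≤ 1

/-- A color-squarefree monomial order ideal: a finite set of color-squarefree monomials,
closed under divisibility, containing `1` and all the variables. -/
def IsOrderIdeal (U : Finset (Mon d m)) : Prop :=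
  (∀ u ∈ U, ColorSquarefree u) ∧
  (∀ u ∈ U, ∀ v : Mon d m, v ≤ u → v ∈ U) ∧
  ((0 : Mon d m) ∈ U) ∧
  (∀ (i : Fin d) (j : Fin (m i)), xvar i j ∈ U)

/-- The strict order `≺` on variables: `x_{i,j} ≺ x_{k,ℓ}` iff `i < k`, or `i = k` and `j < ℓ`. -/
def vlt (a b : Var d m) : Prop :=
  a.1 < b.1 ∨ (a.1 = b.1 ∧ (a.2 : ℕ) < (b.2 : ℕ))

/-- The vertex of color `i` of the facet `F_d(u)`: the (unique) `j` with `x_{i,j} ∣ u` if it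
exists, and the extra vertex `(m i + 1)^{(i)}` otherwise. -/
def vtxOf (u : Mon d m) (i : Fin d) : Fin (m i + 1) :=
  if h : ∃ j : Fin (m i), u ⟨i, j⟩ ≠ 0 then (Classical.choose h).castSucc else Fin.last (m i)

/-- The facet `F_d(u)` associated to a color-squarefree monomial `u`. -/
def Fd (u : Mon d m) : Finset (Vtx d m) :=
  Finset.univ.image fun i : Fin d => (⟨i, vtxOf u i⟩ : Vtx d m)

/-- The balanced (squeezed) complex `Δ_bal(U)` of a finite set `U` of color-squarefree
monomials: the simplicial complex whose facets are the sets `F_d(u)`, `u ∈ U`. -/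
def Dbal (U : Finset (Mon d m)) : Set (Finset (Vtx d m)) :=
  { F | ∃ u ∈ U, F ⊆ Fd u }

theorem vtxOf_spec (u : Mon d m) (i : Fin d) (j : Fin (m i))
    (h : vtxOf u i = j.castSucc) : u ⟨i, j⟩ ≠ 0 := by
  unfold vtxOf at h
  split_ifs at h with hex
  · have h2 := Fin.castSucc_injective _ h
    have h3 := Classical.choose_spec hex
    rwa [h2] at h3
  · exact absurd h.symm (Fin.castSucc_lt_last j).ne

theorem vtxOf_eq (u : Mon d m) (hu : ColorSquarefree u) (i : Fin d) (j : Fin (m i))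
    (h : u ⟨i, j⟩ ≠ 0) : vtxOf u i = j.castSucc := by
  have hex : ∃ j : Fin (m i), u ⟨i, j⟩ ≠ 0 := ⟨j, h⟩
  unfold vtxOf
  rw [dif_pos hex]
  congr 1
  by_contra hne
  have h3 := Classical.choose_spec hex
  have h4 := hu i
  have h5 : ∑ k ∈ ({Classical.choose hex, j} : Finset (Fin (m i))), u ⟨i, k⟩
      ≤ ∑ k : Fin (m i), u ⟨i, k⟩ :=
    Finset.sum_le_sum_of_subset (Finset.subset_univ _)
  rw [Finset.sum_pair hne] at h5
  omega

theorem vtxOf_congr (u v : Mon d m) (i : Fin d) (h : ∀ j, u ⟨i, j⟩ = v ⟨i, j⟩) :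
    vtxOf u i = vtxOf v i := by
  unfold vtxOf
  simp only [h]

/-- Lemma `lemma:deletion`.  Let `U` be a color-squarefree monomial order
ideal, `i` an index with `m i ≥ 1` (witnessed by the variable `x_{i,1}`, i.e. `j0`), and
`Û = {u ∈ U : x_{i,1} ∤ u}`.  The deletion `Δ_bal(U) \ {1^{(i)}}` is the complex generated
by the sets `F_d(u)`, `u ∈ Û`. -/
theorem statement_5 (U : Finset (Mon d m)) (hU : IsOrderIdeal U)
    (i : Fin d) (j0 : Fin (m i)) (hj0 : (j0 : ℕ) = 0) :
    { G : Finset (Vtx d m) | G ∈ Dbal U ∧ (⟨i, j0.castSucc⟩ : Vtx d m) ∉ G } =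
    { G : Finset (Vtx d m) | ∃ u ∈ U, u ⟨i, j0⟩ = 0 ∧ G ⊆ Fd u } := by
  ext G
  simp only [Set.mem_setOf_eq, Dbal]
  constructor
  · rintro ⟨⟨u, hu, hG⟩, hn⟩
    by_cases h0 : u ⟨i, j0⟩ = 0
    · exact ⟨u, hu, h0, hG⟩
    · refine ⟨u.erase ⟨i, j0⟩, hU.2.1 u hu _ ?_, Finsupp.erase_same, ?_⟩
      · intro a
        by_cases ha : a = ⟨i, j0⟩
        · subst ha
          simp
        · rw [Finsupp.erase_ne ha]
      · intro g hg
        have hgu := hG hg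
        simp only [Fd, Finset.mem_image, Finset.mem_univ, true_and] at hgu ⊢
        obtain ⟨k, rfl⟩ := hgu
        by_cases hk : k = i
        · subst hk
          rw [vtxOf_eq u (hU.1 u hu) k j0 h0] at hg
          exact absurd hg hn
        · refine ⟨k, ?_⟩
          rw [vtxOf_congr (u.erase ⟨i, j0⟩) u k]
          intro j
          apply Finsupp.erase_ne
          intro he
          exact hk (congrArg Sigma.fst he)
  · rintro ⟨u, hu, h0, hG⟩
    refine ⟨⟨u, hu, hG⟩, fun hm => ?_⟩
    have hgu := hG hm
    simp only [Fd, Finset.mem_image, Finset.mem_univ, true_and] at hgu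
    obtain ⟨k, hk⟩ := hgu
    obtain rfl : k = i := congrArg Sigma.fst hk
    exact vtxOf_spec u k j0 (eq_of_heq (Sigma.mk.inj hk).2) h0

end BalSq
end
end

section
/- Let I ≠ 0 be a color-squarefree stable (across colors) monomial ideal in P(d,m). Among the monomial minimal generators of I of maximum total degree, let v be the smallest one in the reverse lexicographic order, and let J ⊆ P(d,m) be the ideal generated by the monomial minimal generators of I other than v. Then I = (J, v), J is color-squarefree stable across colors, and the colon ideal J : v equals the ideal generated by the set of variables sm(v). -/
open Finset

noncomputable section

namespace BalSq

variable {d : ℕ} {m : Fin d → ℕ}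

variable (K : Type*) [Field K]

/-- The polynomial ring `P(d,m)`. -/
abbrev PR (d : ℕ) (m : Fin d → ℕ) (K : Type*) [Field K] : Type _ :=
  MvPolynomial (Var d m) K

/-- The monomial of `P(d,m)` with exponent vector `u`. -/
def mon (u : Mon d m) : PR d m K := MvPolynomial.monomial u 1

/-- The ideal `I(U)` generated by all monomials of `P(d,m)` not lying in `U`. -/
def IU (U : Finset (Mon d m)) : Ideal (PR d m K) :=
  Ideal.span { p : PR d m K | ∃ u : Mon d m, u ∉ U ∧ p = mon K u }

/-- The ideal `𝔪_1^2 + ⋯ + 𝔪_d^2` of `P(d,m)`. -/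
def sqIdeal : Ideal (PR d m K) :=
  Ideal.span { p : PR d m K | ∃ (i : Fin d) (j k : Fin (m i)),
    p = mon K (xvar i j + xvar i k) }

/-- A monomial ideal is strongly color-stable if `x_{k,ℓ}·u ∈ I` and `j < ℓ` imply
`x_{k,j}·u ∈ I`. -/
def StronglyColorStable (I : Ideal (PR d m K)) : Prop :=
  ∀ (u : Mon d m) (k : Fin d) (l j : Fin (m k)),
    mon K (xvar k l + u) ∈ I → j < l → mon K (xvar k j + u) ∈ I

/-- Strongly color-stable across colors. -/
def StronglyColorStableAcross (I : Ideal (PR d m K)) : Prop :=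
  StronglyColorStable K I ∧
  ∀ (u : Mon d m) (k : Fin d) (l : Fin (m k)) (i : Fin d) (j : Fin (m i)),
    ColorSquarefree (xvar k l + u) → mon K (xvar k l + u) ∈ I →
    vlt ⟨i, j⟩ ⟨k, l⟩ → ColorSquarefree (xvar i j + u) → mon K (xvar i j + u) ∈ I

/-- The minimal monomial generators of a monomial ideal. -/
def MinGens (I : Ideal (PR d m K)) : Set (Mon d m) :=
  { w | mon K w ∈ I ∧ ∀ v : Mon d m, v ≤ w → v ≠ w → mon K v ∉ I }

/-- `a > b` as variables: `x_{i,j} > x_{k,l}` iff `i < k`, or `i = k` and `j < l`. -/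
def vgt (a b : Var d m) : Prop :=
  a.1 < b.1 ∨ (a.1 = b.1 ∧ (a.2 : ℕ) < (b.2 : ℕ))

/-- `w0` is the smallest variable dividing `u`, i.e. `w0 = min(u)`. -/
def minVarIs (u : Mon d m) (w0 : Var d m) : Prop :=
  u w0 ≠ 0 ∧ ∀ w : Var d m, u w ≠ 0 → w ≠ w0 → vgt w w0

/-- The set `sm(u)` of variables, for a color-squarefree monomial
`u = x_{i_1,j_1}⋯x_{i_s,j_s}`:  all `x_{p,q}` with `p ∈ [i_s] \ cSupp u`, together with all
`x_{i_k,q}` with `q ∈ [j_k - 1]`. -/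
def sm (u : Mon d m) : Set (Var d m) :=
  { w | ((∀ q : Fin (m w.1), u ⟨w.1, q⟩ = 0) ∧
          ∃ (p : Fin d) (q : Fin (m p)), w.1 ≤ p ∧ u ⟨p, q⟩ ≠ 0)
      ∨ (∃ q : Fin (m w.1), u ⟨w.1, q⟩ ≠ 0 ∧ (w.2 : ℕ) < (q : ℕ)) }

/-- A monomial ideal is color-squarefree stable across colors. -/
def CSFStableAcross (I : Ideal (PR d m K)) : Prop :=
  (∀ w ∈ MinGens K I, ColorSquarefree w) ∧
  (∀ (u : Mon d m) (k : Fin d) (l j : Fin (m k)),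
     ColorSquarefree (xvar k l + u) → mon K (xvar k l + u) ∈ I → j < l →
     mon K (xvar k j + u) ∈ I) ∧
  (∀ (u : Mon d m) (k : Fin d) (l : Fin (m k)) (i : Fin d) (j : Fin (m i)),
     ColorSquarefree u → mon K u ∈ I → minVarIs u ⟨k, l⟩ →
     vgt ⟨i, j⟩ ⟨k, l⟩ → ColorSquarefree (xvar i j + (u - xvar k l)) →
     mon K (xvar i j + (u - xvar k l)) ∈ I)

/-- `u` is smaller than `v` in the reverse lexicographic order: at the smallest variable where
they differ, `u` has the larger exponent. -/
def RevLexLT (u v : Mon d m) : Prop :=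
  ∃ w : Var d m, v w < u w ∧ ∀ y : Var d m, vgt w y → u y = v y

theorem mon_mem_span (S : Set (Mon d m)) (u : Mon d m) :
    mon K u ∈ Ideal.span (mon K '' S) ↔ ∃ g ∈ S, g ≤ u := by
  have h := MvPolynomial.mem_ideal_span_monomial_image (x := mon K u) (s := S)
  have h2 : (mon K u).support = {u} := by
    classical
    simp [mon, MvPolynomial.support_monomial]
  rw [h2] at h
  simp only [Finset.mem_singleton, forall_eq] at h
  exact h

theorem mem_of_le {I : Ideal (PR d m K)} {u w : Mon d m} (h : u ≤ w) (hu : mon K u ∈ I) :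
    mon K w ∈ I := by
  have : mon K w = mon K (w - u) * mon K u := by
    simp [mon, MvPolynomial.monomial_mul, tsub_add_cancel_of_le h]
  rw [this]
  exact I.mul_mem_left _ hu

/-- number of variables of color `i` -/
def cs (i : Fin d) (u : Mon d m) : ℕ := ∑ j : Fin (m i), u ⟨i, j⟩

theorem cs_add (i : Fin d) (u w : Mon d m) : cs i (u + w) = cs i u + cs i w := by
  simp [cs, Finset.sum_add_distrib]

theorem cs_xvar (i k : Fin d) (l : Fin (m k)) :
    cs i (xvar k l) = if k = i then 1 else 0 := by
  classical
  unfold cs xvar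
  by_cases h : k = i
  · subst h
    simp [Finsupp.single_apply]
  · simp only [h, if_false]
    apply Finset.sum_eq_zero
    intro j _
    rw [Finsupp.single_apply, if_neg]
    intro hh
    exact h (congrArg Sigma.fst hh)

theorem le_cs (u : Mon d m) (i : Fin d) (j : Fin (m i)) : u ⟨i, j⟩ ≤ cs i u :=
  Finset.single_le_sum (f := fun j => u ⟨i, j⟩) (fun _ _ => Nat.zero_le _) (Finset.mem_univ j)

theorem exists_of_cs (u : Mon d m) (i : Fin d) (h : cs i u ≠ 0) : ∃ j, u ⟨i, j⟩ ≠ 0 := by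
  by_contra! hc
  exact h (Finset.sum_eq_zero fun j _ => hc j)

theorem deg_eq (u : Mon d m) : deg u = ∑ i, cs i u := by
  unfold deg cs
  rw [Finsupp.sum_fintype _ _ (by simp), Fintype.sum_sigma]

theorem deg_add (u w : Mon d m) : deg (u + w) = deg u + deg w := by
  simp [deg_eq, cs_add, Finset.sum_add_distrib]

theorem deg_xvar (k : Fin d) (l : Fin (m k)) : deg (xvar k l) = 1 := by
  simp [deg_eq, cs_xvar]

theorem csf_mono {u w : Mon d m} (h : u ≤ w) (hw : ColorSquarefree w) : ColorSquarefree u :=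
  fun i => (Finset.sum_le_sum fun j _ => h ⟨i, j⟩).trans (hw i)

theorem csf_uniq {u : Mon d m} (hu : ColorSquarefree u) {i : Fin d} {j k : Fin (m i)}
    (hj : u ⟨i, j⟩ ≠ 0) (hk : u ⟨i, k⟩ ≠ 0) : j = k := by
  classical
  by_contra hne
  have h1 : ∑ t ∈ ({j, k} : Finset (Fin (m i))), u ⟨i, t⟩ ≤ ∑ t, u ⟨i, t⟩ :=
    Finset.sum_le_sum_of_subset (Finset.subset_univ _)
  rw [Finset.sum_pair hne] at h1
  have := hu i
  omega

theorem split_var {u : Mon d m} {k : Fin d} {l : Fin (m k)} (h : u ⟨k, l⟩ ≠ 0) :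
    xvar k l + (u - xvar k l) = u := by
  apply add_tsub_cancel_of_le
  unfold xvar
  rw [Finsupp.single_le_iff]
  omega

theorem deg_le {u w : Mon d m} (h : u ≤ w) : deg u ≤ deg w := by
  rw [← add_tsub_cancel_of_le h, deg_add]; omega

theorem eq_of_le_deg {u w : Mon d m} (h : u ≤ w) (hd : deg w ≤ deg u) : u = w := by
  ext ⟨i, j⟩
  by_contra hne
  have h0 : (w - u) ⟨i, j⟩ ≠ 0 := by
    have := h ⟨i, j⟩
    simp only [Finsupp.tsub_apply]
    omega
  have h1 : deg w = deg u + deg (w - u) := by rw [← deg_add, add_tsub_cancel_of_le h]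
  have h2 := congrArg deg (split_var h0)
  rw [deg_add, deg_xvar] at h2
  omega

theorem vgt_irrefl (a : Var d m) : ¬ vgt a a := by
  simp [vgt]

theorem vgt_tri (a b : Var d m) (h : a ≠ b) : vgt a b ∨ vgt b a := by
  obtain ⟨i, j⟩ := a
  obtain ⟨k, l⟩ := b
  unfold vgt
  rcases lt_trichotomy i k with h1 | h1 | h1
  · simp [h1]
  · subst h1
    have : j ≠ l := fun hh => h (by rw [hh])
    have : (j : ℕ) ≠ l := fun hh => this (Fin.ext hh)
    simp
    omega
  · simp [h1]

theorem vgt_trans {a b c : Var d m} (h : vgt a b) (h' : vgt b c) : vgt a c := by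
  unfold vgt at *
  rcases h with h | ⟨h, h1⟩ <;> rcases h' with h' | ⟨h', h2⟩
  · exact Or.inl (h.trans h')
  · exact Or.inl (h' ▸ h)
  · exact Or.inl (h ▸ h')
  · exact Or.inr ⟨h.trans h', h1.trans h2⟩

theorem exists_min (u : Mon d m) (b : Var d m) (hb : u b ≠ 0) : ∃ a, minVarIs u a := by
  classical
  have wf : WellFounded (fun a b : Var d m => vgt b a) := by
    haveI : IsTrans (Var d m) (fun a b : Var d m => vgt b a) := ⟨fun _ _ _ h h' => vgt_trans h' h⟩
    haveI : Std.Irrefl (fun a b : Var d m => vgt b a) := ⟨fun a => vgt_irrefl a⟩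
    exact Finite.wellFounded_of_trans_of_irrefl _
  obtain ⟨a, ha, hmin⟩ := wf.has_min {a | u a ≠ 0} ⟨b, hb⟩
  refine ⟨a, ha, fun w hw hne => ?_⟩
  rcases vgt_tri w a hne with h | h
  · exact h
  · exact absurd h (hmin w hw)

/-- variables of `u` relative to `v` -/
def Kind (v u : Mon d m) : Prop :=
  ∀ y : Var d m, u y ≠ 0 → (∃ q : Fin (m y.1), v ⟨y.1, q⟩ ≠ 0 ∧ (q : ℕ) ≤ (y.2 : ℕ)) ∨
    (∀ (p : Fin d) (q : Fin (m p)), v ⟨p, q⟩ ≠ 0 → p < y.1)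

/-- number of variables of `u` outside `v` -/
def mu (v u : Mon d m) : ℕ := ∑ w, if v w = 0 then u w else 0

theorem mu_add (v u w : Mon d m) : mu v (u + w) = mu v u + mu v w := by
  unfold mu
  rw [← Finset.sum_add_distrib]
  apply Finset.sum_congr rfl
  intro x _
  split_ifs <;> simp

theorem mu_xvar (v : Mon d m) (k : Fin d) (l : Fin (m k)) :
    mu v (xvar k l) = if v ⟨k, l⟩ = 0 then 1 else 0 := by
  classical
  unfold mu xvar
  rw [Finset.sum_eq_single ⟨k, l⟩]
  · simp
  · intro b _ hb
    simp [Finsupp.single_apply, hb.symm]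
  · simp

theorem kind_swap {v r : Mon d m} {k i : Fin d} {l : Fin (m k)} {j : Fin (m i)}
    (h : Kind v (xvar k l + r)) (hv : v ⟨i, j⟩ ≠ 0) : Kind v (xvar i j + r) := by
  classical
  intro y hy
  by_cases hr : r y = 0
  · have : y = ⟨i, j⟩ := by
      by_contra hne
      apply hy
      simp [xvar, Finsupp.single_apply, hr, Ne.symm hne]
    subst this
    exact Or.inl ⟨j, hv, le_rfl⟩
  · exact h y (by simp [hr])

theorem no_small (I : Ideal (PR d m K)) (hstable : CSFStableAcross K I)
    (v : Mon d m) (hv : v ∈ MinGens K I) :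
    ∀ (n : ℕ) (u : Mon d m), mu v u = n → ColorSquarefree u → mon K u ∈ I → deg u < deg v →
      Kind v u → False := by
  intro n
  induction n with
  | zero =>
    intro u hmu hu huI hd hk
    have hle : u ≤ v := by
      rintro ⟨i, j⟩
      by_cases h0 : v ⟨i, j⟩ = 0
      · have : (if v ⟨i, j⟩ = 0 then u ⟨i, j⟩ else 0) = 0 := by
          have := (Finset.sum_eq_zero_iff (s := (Finset.univ : Finset (Var d m)))
            (f := fun w => if v w = 0 then u w else 0)).1 hmu
          exact this ⟨i, j⟩ (Finset.mem_univ _)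
        rw [if_pos h0] at this
        omega
      · have h1 := le_cs u i j
        have h2 : cs i u ≤ 1 := hu i
        omega
    exact hv.2 u hle (fun h => by rw [h] at hd; omega) huI
  | succ n ih =>
    intro u hmu hu huI hd hk
    have hvc := hstable.1 v hv
    by_cases hA : ∃ (c : Fin d) (q q' : Fin (m c)), u ⟨c, q⟩ ≠ 0 ∧ v ⟨c, q⟩ = 0 ∧
        v ⟨c, q'⟩ ≠ 0 ∧ (q' : ℕ) ≤ q
    · obtain ⟨c, q, q', h1, h2, h3, h4⟩ := hA
      have hlt : q' < q := by
        rcases lt_or_eq_of_le (show q' ≤ q from h4) with h | h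
        · exact h
        · subst h; exact absurd h2 h3
      obtain ⟨r, rfl⟩ : ∃ r, u = xvar c q + r := ⟨_, (split_var h1).symm⟩
      refine ih (xvar c q' + r) ?_ ?_ (hstable.2.1 r c q q' hu huI hlt) ?_ (kind_swap hk h3)
      · rw [mu_add, mu_xvar] at *
        simp only [h2, h3, if_true, if_false] at *
        omega
      · intro i
        have := hu i
        change cs i _ ≤ 1 at this
        change cs i _ ≤ 1
        rw [cs_add, cs_xvar] at *
        exact this
      · rw [deg_add, deg_xvar] at *
        exact hd
    · have hB : ∃ b : Var d m, u b ≠ 0 ∧ v b = 0 := by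
        by_contra! hc
        have : mu v u = 0 := by
          apply Finset.sum_eq_zero
          intro w _
          split_ifs with h
          · by_contra h'
            exact hc w h' h
          · rfl
        omega
      obtain ⟨b, hb, hb0⟩ := hB
      have hb2 : ∀ (p : Fin d) (q : Fin (m p)), v ⟨p, q⟩ ≠ 0 → p < b.1 := by
        rcases hk b hb with ⟨q, h1, h2⟩ | h
        · exact absurd ⟨b.1, b.2, q, hb, hb0, h1, h2⟩ hA
        · exact h
      obtain ⟨⟨k, l⟩, ha⟩ := exists_min u b hb
      have hbk : b.1 ≤ k := by
        by_cases hh : b = ⟨k, l⟩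
        · rw [hh]
        · rcases ha.2 b hb hh with h | h
          · exact h.le
          · exact h.1.le
      obtain ⟨i, -, hi⟩ := Finset.exists_lt_of_sum_lt (by rw [← deg_eq, ← deg_eq]; exact hd :
        ∑ i, cs i u < ∑ i, cs i v)
      have hi1 : cs i v ≤ 1 := hvc i
      obtain ⟨j, hj⟩ := exists_of_cs v i (by omega)
      have hik : i < k := (hb2 i j hj).trans_le hbk
      have hcu : cs i u = 0 := by omega
      have hvk : v ⟨k, l⟩ = 0 := by
        by_contra h
        exact absurd (hb2 k l h) (not_lt.2 hbk)
      have key := hstable.2.2 u k l i j hu huI ha (Or.inl hik)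
      have h1 := ha.1
      generalize hr : u - xvar k l = r at key
      have hur : u = xvar k l + r := by rw [← hr, split_var h1]
      subst hur
      have hcsf : ColorSquarefree (xvar i j + r) := by
        intro t
        have := hu t
        change cs t _ ≤ 1 at this
        change cs t _ ≤ 1
        rw [cs_add, cs_xvar] at *
        by_cases hti : i = t
        · subst hti
          simp only [if_true]
          omega
        · rw [if_neg hti]
          omega
      refine ih _ ?_ hcsf (key hcsf) ?_ (kind_swap hk hj)
      · rw [mu_add, mu_xvar] at *
        simp only [hvk, hj, if_true, if_false] at *
        omega
      · rw [deg_add, deg_xvar] at *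
        exact hd

theorem no_div (I : Ideal (PR d m K)) (hstable : CSFStableAcross K I)
    (v : Mon d m) (hv : v ∈ MinGens K I)
    (hmax : ∀ w ∈ MinGens K I, deg w ≤ deg v)
    (hsmall : ∀ w ∈ MinGens K I, deg w = deg v → w ≠ v → RevLexLT v w)
    (u : Mon d m) (hu : u ∈ MinGens K I) (huv : u ≠ v) (hk : Kind v u) : False := by
  have huc := hstable.1 u hu
  have hvc := hstable.1 v hv
  rcases lt_or_eq_of_le (hmax u hu) with hd | hd
  · exact no_small K I hstable v hv _ u rfl huc hu.1 hd hk
  · obtain ⟨⟨c, t⟩, hw, hy⟩ := hsmall u hu hd huv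
    have hk1 : ∀ (i : Fin d) (q : Fin (m i)), u ⟨i, q⟩ ≠ 0 →
        ∃ q' : Fin (m i), v ⟨i, q'⟩ ≠ 0 ∧ (q' : ℕ) ≤ q := by
      intro i q h
      rcases hk ⟨i, q⟩ h with h' | h'
      · exact h'
      · exfalso
        have h1 : c < i := h' c t (by omega)
        have h2 := hy ⟨i, q⟩ (Or.inl h1)
        exact lt_irrefl _ (h' i q (by omega))
    have hle : ∀ i ∈ (Finset.univ : Finset (Fin d)), cs i u ≤ cs i v := by
      intro i _
      by_cases h0 : cs i u = 0
      · omega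
      · obtain ⟨q, hq⟩ := exists_of_cs u i h0
        obtain ⟨q', hq', -⟩ := hk1 i q hq
        have h1 := le_cs v i q'
        have h2 : cs i u ≤ 1 := huc i
        omega
    have heq := (Finset.sum_eq_sum_iff_of_le hle).1 (by rw [← deg_eq, ← deg_eq]; exact hd)
      c (Finset.mem_univ _)
    have h1 := le_cs v c t
    have h2 : cs c v ≤ 1 := hvc c
    obtain ⟨q, hq⟩ := exists_of_cs u c (by omega)
    obtain ⟨q', hq', hle'⟩ := hk1 c q hq
    have hvt : v ⟨c, t⟩ ≠ 0 := by omega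
    have := csf_uniq hvc hq' hvt
    subst this
    have hne : q' ≠ q := by
      rintro rfl
      omega
    have hne' : (q' : ℕ) ≠ q := fun h => hne (Fin.ext h)
    have h3 := hy ⟨c, q⟩ (Or.inr ⟨rfl, by simp only; omega⟩)
    exact hne (csf_uniq hvc hq' (by omega))

theorem swap_mem (I : Ideal (PR d m K))
    (hmono : I = Ideal.span (mon K '' MinGens K I))
    (v : Mon d m)
    (hmax : ∀ w ∈ MinGens K I, deg w ≤ deg v)
    (hsmall : ∀ w ∈ MinGens K I, deg w = deg v → w ≠ v → RevLexLT v w)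
    (k : Fin d) (l : Fin (m k)) (i : Fin d) (j : Fin (m i)) (r : Mon d m)
    (hh : xvar k l + r ∈ MinGens K I) (hne : xvar k l + r ≠ v)
    (hgt : vgt (⟨i, j⟩ : Var d m) ⟨k, l⟩) (hmem : mon K (xvar i j + r) ∈ I) :
    ∃ g ∈ MinGens K I \ {v}, g ≤ xvar i j + r := by
  classical
  rw [hmono, mon_mem_span] at hmem
  obtain ⟨g, hg, hle⟩ := hmem
  by_cases hgv : g = v
  · exfalso
    subst hgv
    have hd := hmax _ hh
    have hd2 := deg_le hle
    rw [deg_add, deg_xvar] at hd hd2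
    have hgeq : g = xvar i j + r := eq_of_le_deg hle (by rw [deg_add, deg_xvar]; omega)
    subst hgeq
    obtain ⟨w, hw, hy⟩ := hsmall _ hh (by simp only [deg_add, deg_xvar]) hne
    have hw' : w = ⟨i, j⟩ := by
      by_contra hne'
      simp [xvar, Finsupp.single_apply, Ne.symm hne'] at hw
    subst hw'
    have := hy _ hgt
    have hne2 : (⟨i, j⟩ : Var d m) ≠ ⟨k, l⟩ := by
      intro e
      rw [e] at hgt
      exact vgt_irrefl _ hgt
    rw [Finsupp.add_apply, Finsupp.add_apply, xvar, xvar, Finsupp.single_eq_same,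
      Finsupp.single_apply, if_neg hne2] at this
    omega
  · exact ⟨g, ⟨hg, hgv⟩, hle⟩

/-- Proposition `prop:lin quotient`.  Let `I ≠ 0` be a color-squarefree
stable across colors monomial ideal, let `v` be the revlex-smallest minimal generator of
maximal degree, and let `J` be generated by the remaining minimal generators.  Then
`I = (J, v)`, `J` is color-squarefree stable across colors, and `J : v = (sm v)`. -/
theorem statement_13 (I : Ideal (PR d m K)) (hI : I ≠ ⊥)
    (hmono : I = Ideal.span (mon K '' MinGens K I))
    (hstable : CSFStableAcross K I)
    (v : Mon d m) (hv : v ∈ MinGens K I)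
    (hmax : ∀ w ∈ MinGens K I, deg w ≤ deg v)
    (hsmall : ∀ w ∈ MinGens K I, deg w = deg v → w ≠ v → RevLexLT v w)
    (J : Ideal (PR d m K)) (hJ : J = Ideal.span (mon K '' (MinGens K I \ {v}))) :
    I = J ⊔ Ideal.span {mon K v} ∧
    CSFStableAcross K J ∧
    (∀ f : PR d m K, f * mon K v ∈ J ↔
      f ∈ Ideal.span ((fun w => (MvPolynomial.X w : PR d m K)) '' sm v)) := by
  classical
  have hJmem : ∀ u : Mon d m, mon K u ∈ J ↔ ∃ g ∈ MinGens K I \ {v}, g ≤ u := fun u => by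
    rw [hJ, mon_mem_span]
  have hvc := hstable.1 v hv
  refine ⟨?_, ⟨?_, ?_, ?_⟩, ?_⟩
  · rw [hJ, ← Ideal.span_union, ← Set.image_singleton, ← Set.image_union,
      Set.diff_union_of_subset (Set.singleton_subset_iff.2 hv)]
    exact hmono
  · intro w hw
    obtain ⟨g, hg, hle⟩ := (hJmem w).1 hw.1
    by_cases h : g = w
    · exact h ▸ hstable.1 g hg.1
    · exact absurd ((hJmem g).2 ⟨g, hg, le_rfl⟩) (hw.2 g hle h)
  · intro u k l j hc hmem hjl
    obtain ⟨g, hg, hle⟩ := (hJmem _).1 hmem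
    by_cases h0 : g ⟨k, l⟩ = 0
    · rw [hJmem]
      refine ⟨g, hg, fun y => ?_⟩
      by_cases hy : y = ⟨k, l⟩
      · subst hy; omega
      · have := hle y
        rw [Finsupp.add_apply, xvar, Finsupp.single_apply, if_neg (Ne.symm hy)] at this
        rw [Finsupp.add_apply]
        omega
    · obtain ⟨r, rfl⟩ : ∃ r, g = xvar k l + r := ⟨_, (split_var h0).symm⟩
      have h1 := hstable.2.1 r k l j (hstable.1 _ hg.1) hg.1.1 hjl
      obtain ⟨g', hg', hle'⟩ := swap_mem K I hmono v hmax hsmall k l k j r hg.1 hg.2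
        (Or.inr ⟨rfl, hjl⟩) h1
      rw [hJmem]
      exact ⟨g', hg', hle'.trans (add_le_add_right (le_of_add_le_add_left hle) _)⟩
  · intro u k l i j hc hmem hmin hgt hc'
    obtain ⟨g, hg, hle⟩ := (hJmem _).1 hmem
    generalize hr : u - xvar k l = s at hc' ⊢
    have hur : u = xvar k l + s := by rw [← hr, split_var hmin.1]
    subst hur
    by_cases h0 : g ⟨k, l⟩ = 0
    · rw [hJmem]
      refine ⟨g, hg, fun y => ?_⟩
      by_cases hy : y = ⟨k, l⟩
      · subst hy; omega
      · have := hle y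
        rw [Finsupp.add_apply, xvar, Finsupp.single_apply, if_neg (Ne.symm hy)] at this
        rw [Finsupp.add_apply]
        omega
    · obtain ⟨r, rfl⟩ : ∃ r, g = xvar k l + r := ⟨_, (split_var h0).symm⟩
      have hrs : r ≤ s := le_of_add_le_add_left hle
      have hle2 : xvar i j + r ≤ xvar i j + s := add_le_add_right hrs _
      have hgmin : minVarIs (xvar k l + r) ⟨k, l⟩ := by
        refine ⟨h0, fun w hw hne => hmin.2 w ?_ hne⟩
        have := hle w
        omega
      have h1 := hstable.2.2 (xvar k l + r) k l i j (hstable.1 _ hg.1) hg.1.1 hgmin hgt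
      rw [add_tsub_cancel_left] at h1
      obtain ⟨g', hg', hle'⟩ := swap_mem K I hmono v hmax hsmall k l i j r hg.1 hg.2
        hgt (h1 (csf_mono hle2 hc'))
      rw [hJmem]
      exact ⟨g', hg', hle'.trans hle2⟩
  · intro f
    have hsm : ∀ w ∈ sm v, mon K (Finsupp.single w 1 + v) ∈ J := by
      rintro ⟨p, q⟩ hw
      have main : ∀ (k : Fin d) (l : Fin (m k)), v ⟨k, l⟩ ≠ 0 → (⟨p, q⟩ : Var d m) ≠ ⟨k, l⟩ →
          mon K (xvar p q + (v - xvar k l)) ∈ I → mon K (xvar p q + v) ∈ J := by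
        intro k l h0 hne hm
        rw [hmono, mon_mem_span] at hm
        obtain ⟨g, hg, hle⟩ := hm
        rw [hJmem]
        refine ⟨g, ⟨hg, ?_⟩, hle.trans (add_le_add_right tsub_le_self _)⟩
        rintro rfl
        have h1 := hle ⟨k, l⟩
        rw [Finsupp.add_apply, Finsupp.tsub_apply, xvar, xvar, Finsupp.single_apply, if_neg hne,
          Finsupp.single_eq_same] at h1
        omega
      rcases hw with ⟨hz, p', q', hp, hnz⟩ | ⟨l, hl, hlt⟩
      · obtain ⟨⟨k, l⟩, ha⟩ := exists_min v _ hnz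
        have hpk : p' ≤ k := by
          by_cases hh : (⟨p', q'⟩ : Var d m) = ⟨k, l⟩
          · exact (congrArg Sigma.fst hh).le
          · rcases ha.2 _ hnz hh with h | h
            · exact h.le
            · exact h.1.le
        have hlt : p < k := by
          rcases lt_or_eq_of_le (le_trans hp hpk) with h | h
          · exact h
          · exfalso
            simp only at h
            subst h
            exact ha.1 (hz l)
        refine main k l ha.1 (fun e => hlt.ne (congrArg Sigma.fst e)) ?_
        refine hstable.2.2 v k l p q hvc hv.1 ha (Or.inl hlt) ?_
        intro t
        change cs t _ ≤ 1
        rw [cs_add, cs_xvar]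
        have h1 : cs t (v - xvar k l) ≤ cs t v :=
          Finset.sum_le_sum fun j _ => (tsub_le_self : v - xvar k l ≤ v) _
        have h2 : cs t v ≤ 1 := hvc t
        by_cases hpt : p = t
        · subst hpt
          have : cs p v = 0 := Finset.sum_eq_zero fun j _ => hz j
          simp only [if_true]
          omega
        · rw [if_neg hpt]
          omega
      · simp only at l hl hlt
        refine main p l hl ?_ ?_
        · intro e
          have : q = l := by simpa using e
          subst this
          exact lt_irrefl _ hlt
        · refine hstable.2.1 _ p l q ?_ ?_ hlt
          · rw [split_var hl]; exact hvc
          · rw [split_var hl]; exact hv.1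
    rw [MvPolynomial.mem_ideal_span_X_image]
    have hJm : ∀ x : PR d m K, x ∈ J ↔ ∀ xi ∈ x.support, ∃ si ∈ MinGens K I \ {v}, si ≤ xi := by
      intro x
      rw [hJ]
      exact MvPolynomial.mem_ideal_span_monomial_image
    have hsupp : ∀ n ∈ f.support, n + v ∈ (f * mon K v).support := by
      intro n hn
      rw [MvPolynomial.mem_support_iff] at hn ⊢
      unfold mon
      rw [MvPolynomial.coeff_mul_monomial, mul_one]
      exact hn
    constructor
    · intro hf n hn
      rw [hJm] at hf
      obtain ⟨u, hu, hle⟩ := hf _ (hsupp n hn)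
      by_contra! hno
      refine no_div K I hstable v hv hmax hsmall u hu.1 hu.2 ?_
      intro y hy
      by_cases hvy : v y = 0
      · have hny : n y ≠ 0 := by
          have := hle y
          rw [Finsupp.add_apply] at this
          omega
        have hns : y ∉ sm v := fun h => hny (hno y h)
        by_cases hz : ∀ q : Fin (m y.1), v ⟨y.1, q⟩ = 0
        · right
          intro p q hpq
          by_contra hlt
          exact hns (Or.inl ⟨hz, p, q, not_lt.1 hlt, hpq⟩)
        · left
          push Not at hz
          obtain ⟨q, hq⟩ := hz
          refine ⟨q, hq, ?_⟩
          by_contra hlt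
          exact hns (Or.inr ⟨q, hq, not_le.1 hlt⟩)
      · exact Or.inl ⟨y.2, hvy, le_rfl⟩
    · intro hf
      rw [f.as_sum, Finset.sum_mul]
      refine J.sum_mem fun n hn => ?_
      obtain ⟨w, hw, hnw⟩ := hf n hn
      have h1 : MvPolynomial.monomial n (f.coeff n) * mon K v =
          MvPolynomial.C (f.coeff n) * mon K (n + v) := by
        simp [mon, MvPolynomial.monomial_mul, MvPolynomial.C_mul_monomial]
      rw [h1]
      refine J.mul_mem_left _ (mem_of_le K (add_le_add_left ?_ v) (hsm w hw))
      rw [Finsupp.single_le_iff]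
      omega

end BalSq
end
end
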